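/- Energy dissipation law for the IEQ-transformed system: let ε ∈ ℝ, B ∈ ℝ, let F : ℝ → ℝ be smooth with F(s) + B > 0 for all s, set H(s) = F'(s)/√(F(s)+B), let M : ℝ → ℝ be smooth with M(s) ≥ 0 for all s, and let φ, U : ℝ × ℝᵈ → ℝ be smooth and ℤᵈ-periodic in the space variable. Define μ(t,x) = −ε²Δφ(t,x) + U(t,x)H(φ(t,x)) and suppose ∂ₜφ(t,x) = div(M(φ(t,·))∇μ(t,·))(x) and ∂ₜU(t,x) = (1/2)H(φ(t,x))∂ₜφ(t,x) for all (t,x). Then for every t the map t ↦ ∫_Q (ε²/2 |∇φ(t,x)|² + U(t,x)²) dx is differentiable with derivative −∫_Q M(φ(t,x)) |∇μ(t,x)|² dx ≤ 0. -/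

import Mathlib

open MeasureTheory Real

noncomputable section

/-- `ℝᵈ` as a Euclidean space. -/
abbrev Esp (d : ℕ) := EuclideanSpace ℝ (Fin d)

/-- The unit cell `Q = [0,1]^d`. -/
def unitCube (d : ℕ) : Set (Esp d) := {x | ∀ i, 0 ≤ x i ∧ x i ≤ 1}

/-- `ℤᵈ`-periodicity of a (scalar- or vector-valued) function on `ℝᵈ`. -/
def ZPer {d : ℕ} {α : Type*} (g : Esp d → α) : Prop :=
  ∀ (x : Esp d) (k : Fin d → ℤ),
    g (x + (WithLp.equiv 2 (Fin d → ℝ)).symm (fun i => (k i : ℝ))) = g x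

/-- Divergence of a vector field on `ℝᵈ`. -/
def pdiv {d : ℕ} (F : Esp d → Esp d) (x : Esp d) : ℝ :=
  ∑ i, fderiv ℝ (fun y => F y i) x (EuclideanSpace.single i 1)

/-- Laplacian of a scalar field on `ℝᵈ`. -/
def plap {d : ℕ} (f : Esp d → ℝ) (x : Esp d) : ℝ := pdiv (gradient f) x
theorem isCompact_unitCube (d : ℕ) : IsCompact (unitCube d) := by
  have h : unitCube d = WithLp.toLp 2 '' Set.Icc (0 : Fin d → ℝ) 1 := by
    ext x
    constructor
    · intro hx
      exact ⟨WithLp.ofLp x, ⟨fun i => (hx i).1, fun i => (hx i).2⟩, rfl⟩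
    · rintro ⟨y, hy, rfl⟩ i
      exact ⟨hy.1 i, hy.2 i⟩
  rw [h]
  exact isCompact_Icc.image (PiLp.continuous_toLp 2 _)

/-- Differentiation under the integral sign over a compact set. -/
theorem hasDerivAt_setIntegral_of_contDiff {E : Type*} [NormedAddCommGroup E] [NormedSpace ℝ E]
    [MeasurableSpace E] [BorelSpace E] [SecondCountableTopology E] (ν : Measure E)
    [IsFiniteMeasureOnCompacts ν] {K : Set E} (hK : IsCompact K) {G : ℝ × E → ℝ}
    (hG : ContDiff ℝ 1 G) (t : ℝ) :
    HasDerivAt (fun s => ∫ x in K, G (s, x) ∂ν)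
      (∫ x in K, fderiv ℝ G (t, x) (1, 0) ∂ν) t := by
  have hc : Continuous fun p : ℝ × E => fderiv ℝ G p (1, 0) :=
    (hG.continuous_fderiv one_ne_zero).clm_apply continuous_const
  obtain ⟨C, hC⟩ := ((isCompact_Icc (a := t - 1) (b := t + 1)).prod hK).exists_bound_of_continuousOn
    hc.continuousOn
  have hs : Set.Icc (t - 1) (t + 1) ∈ nhds t := Icc_mem_nhds (by linarith) (by linarith)
  have hGs : ∀ s : ℝ, Continuous fun x => G (s, x) := fun s =>
    hG.continuous.comp (by fun_prop)
  refine (hasDerivAt_integral_of_dominated_loc_of_deriv_le (bound := fun _ => C)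
    (F' := fun s x => fderiv ℝ G (s, x) (1, 0)) hs
    (.of_forall fun s => (hGs s).aestronglyMeasurable)
    ((hGs t).continuousOn.integrableOn_compact hK)
    (hc.comp (by fun_prop : Continuous fun x : E => (t, x))).aestronglyMeasurable ?_ ?_ ?_).2
  · exact (ae_restrict_iff' hK.measurableSet).2
      (.of_forall fun x hx s hs => hC (s, x) ⟨hs, hx⟩)
  · exact continuousOn_const.integrableOn_compact hK
  · refine .of_forall fun x s _ => ?_
    exact (hG.differentiable one_ne_zero (s, x)).hasFDerivAt.comp_hasDerivAt s
      ((hasDerivAt_id s).prodMk (hasDerivAt_const s x))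

theorem gradient_apply_eq_fderiv {d : ℕ} (f : Esp d → ℝ) (x : Esp d) (i : Fin d) :
    gradient f x i = fderiv ℝ f x (EuclideanSpace.single i 1) := by
  rw [← toDual_gradient, InnerProductSpace.toDual_apply_apply,
    EuclideanSpace.inner_single_right]
  simp

theorem ZPer.gradient {d : ℕ} {f : Esp d → ℝ} (hf : ZPer f) : ZPer (gradient f) := by
  intro x k
  have h := fderiv_comp_add_right (𝕜 := ℝ) (f := f) (x := x)
    ((WithLp.equiv 2 (Fin d → ℝ)).symm fun i => (k i : ℝ))
  have h2 : (fun y => f (y + (WithLp.equiv 2 (Fin d → ℝ)).symm fun i => (k i : ℝ))) = f :=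
    funext fun y => hf y k
  rw [h2] at h
  simp only [_root_.gradient, h]

theorem ZPer.pdiv {d : ℕ} {V : Esp d → Esp d} (hV : ZPer V) : ZPer (pdiv V) := by
  intro x k
  refine Finset.sum_congr rfl fun i _ => ?_
  have h := fderiv_comp_add_right (𝕜 := ℝ) (f := fun y => V y i) (x := x)
    ((WithLp.equiv 2 (Fin d → ℝ)).symm fun i => (k i : ℝ))
  have h2 : (fun y => V (y + (WithLp.equiv 2 (Fin d → ℝ)).symm fun i => (k i : ℝ)) i)
      = fun y => V y i := funext fun y => by rw [hV y k]
  rw [h2] at h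
  rw [h]

/-- The integral of the divergence of a periodic field over a period cell vanishes. -/
theorem integral_pdiv_eq_zero {d : ℕ} {V : Esp d → Esp d} (hV : ContDiff ℝ 1 V) (hper : ZPer V) :
    ∫ x in unitCube d, pdiv V x = 0 := by
  obtain _ | n := d
  · simp [pdiv]
  have hVi : ∀ i, ContDiff ℝ 1 fun y => V y i := fun i => contDiff_euclidean.1 hV i
  let L := (EuclideanSpace.equiv (Fin (n + 1)) ℝ).symm
  have hpre : WithLp.ofLp ⁻¹' Set.Icc (0 : Fin (n + 1) → ℝ) 1 = unitCube (n + 1) := by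
    ext x
    exact ⟨fun h i => ⟨h.1 i, h.2 i⟩, fun h => ⟨fun i => (h i).1, fun i => (h i).2⟩⟩
  have hcv : ∫ x in unitCube (n + 1), pdiv V x
      = ∫ x in Set.Icc (0 : Fin (n + 1) → ℝ) 1, pdiv V (L x) := by
    rw [← (PiLp.volume_preserving_ofLp (Fin (n + 1))).setIntegral_preimage_emb
      (MeasurableEquiv.toLp 2 (Fin (n + 1) → ℝ)).symm.measurableEmbedding, hpre]
    rfl
  have hdiv := integral_divergence_of_hasFDerivAt_off_countable' (0 : Fin (n + 1) → ℝ) 1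
    zero_le_one (fun i x => V (L x) i)
    (fun i x => (fderiv ℝ (fun y => V y i) (L x)).comp (L : (Fin (n + 1) → ℝ) →L[ℝ] Esp (n + 1)))
    ∅ Set.countable_empty
    (fun i => ((hVi i).continuous.comp L.continuous).continuousOn)
    (fun x _ i => ((hVi i).differentiable one_ne_zero (L x)).hasFDerivAt.comp x L.hasFDerivAt)
    (by
      refine ContinuousOn.integrableOn_compact isCompact_Icc (Continuous.continuousOn ?_)
      refine continuous_finsetSum _ fun i _ => ?_
      exact ((((hVi i).continuous_fderiv one_ne_zero).comp L.continuous).clm_comp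
        continuous_const).clm_apply continuous_const)
  rw [hcv]
  refine Eq.trans ?_ (hdiv.trans ?_)
  · rfl
  · refine Finset.sum_eq_zero fun i _ => sub_eq_zero.2 (integral_congr_ae (.of_forall fun x => ?_))
    have h := hper (L (i.insertNth 0 x)) (Pi.single i 1)
    have h2 : L (i.insertNth 0 x) + (WithLp.equiv 2 (Fin (n + 1) → ℝ)).symm
        (fun j => ((Pi.single i 1 : Fin (n + 1) → ℤ) j : ℝ)) = L (i.insertNth 1 x) := by
      ext j
      refine Fin.succAboveCases i ?_ (fun j => ?_) j
      · simp [L]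
      · simp [L]
    rw [h2] at h
    exact congrArg (fun v : Esp (n + 1) => v i) h

theorem pdiv_smul {d : ℕ} {f : Esp d → ℝ} {V : Esp d → Esp d} {x : Esp d}
    (hf : DifferentiableAt ℝ f x) (hV : DifferentiableAt ℝ V x) :
    pdiv (fun y => f y • V y) x = inner ℝ (gradient f x) (V x) + f x * pdiv V x := by
  rw [pdiv, pdiv, Finset.mul_sum, PiLp.inner_apply, ← Finset.sum_add_distrib]
  refine Finset.sum_congr rfl fun i _ => ?_
  have hVi : DifferentiableAt ℝ (fun y => V y i) x := differentiableAt_euclidean.1 hV i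
  rw [gradient_apply_eq_fderiv]
  simp only [PiLp.smul_apply, smul_eq_mul]
  rw [fderiv_fun_mul hf hVi]
  simp
  ring

theorem pdiv_add {d : ℕ} {V W : Esp d → Esp d} {x : Esp d}
    (hV : DifferentiableAt ℝ V x) (hW : DifferentiableAt ℝ W x) :
    pdiv (fun y => V y + W y) x = pdiv V x + pdiv W x := by
  rw [pdiv, pdiv, pdiv, ← Finset.sum_add_distrib]
  refine Finset.sum_congr rfl fun i _ => ?_
  have hVi : DifferentiableAt ℝ (fun y => V y i) x := differentiableAt_euclidean.1 hV i
  have hWi : DifferentiableAt ℝ (fun y => W y i) x := differentiableAt_euclidean.1 hW i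
  simp only [PiLp.add_apply]
  rw [fderiv_fun_add hVi hWi]
  simp

section Slices

variable {d : ℕ} {f : ℝ × Esp d → ℝ}

theorem deriv_slice (hf : Differentiable ℝ f) (t : ℝ) (x : Esp d) :
    deriv (fun s => f (s, x)) t = fderiv ℝ f (t, x) (1, 0) :=
  ((hf (t, x)).hasFDerivAt.comp_hasDerivAt t
    ((hasDerivAt_id t).prodMk (hasDerivAt_const t x))).deriv

theorem gradient_slice_apply (hf : Differentiable ℝ f) (t : ℝ) (x : Esp d) (i : Fin d) :
    gradient (fun y => f (t, y)) x i = fderiv ℝ f (t, x) (0, EuclideanSpace.single i 1) := by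
  rw [gradient_apply_eq_fderiv]
  have h : HasFDerivAt (fun y => f (t, y)) _ x :=
    (hf (t, x)).hasFDerivAt.comp x (hasFDerivAt_prodMk_right t x)
  rw [h.fderiv]
  simp

theorem ContDiff.fderiv_apply_const {E : Type*} [NormedAddCommGroup E] [NormedSpace ℝ E]
    {g : E → ℝ} (hg : ContDiff ℝ (⊤ : ℕ∞) g) (v : E) :
    ContDiff ℝ (⊤ : ℕ∞) fun p => fderiv ℝ g p v :=
  (hg.fderiv_right (m := (⊤ : ℕ∞)) (by simp)).clm_apply contDiff_const

theorem fderiv_fderiv_apply_comm {E : Type*} [NormedAddCommGroup E] [NormedSpace ℝ E]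
    {g : E → ℝ} (hg : ContDiff ℝ (⊤ : ℕ∞) g) (v w p : E) :
    fderiv ℝ (fun q => fderiv ℝ g q v) p w = fderiv ℝ (fun q => fderiv ℝ g q w) p v := by
  have hd : DifferentiableAt ℝ (fderiv ℝ g) p :=
    (hg.fderiv_right (m := 1) (by norm_cast)).differentiable one_ne_zero p
  have hsymm : IsSymmSndFDerivAt ℝ g p := hg.contDiffAt.isSymmSndFDerivAt (by
    rw [minSmoothness_of_isRCLikeNormedField]
    norm_cast)
  rw [fderiv_clm_apply hd (differentiableAt_const v), fderiv_clm_apply hd (differentiableAt_const w)]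
  simpa using hsymm w v

theorem contDiff_gradient_slice (hf : ContDiff ℝ (⊤ : ℕ∞) f) :
    ContDiff ℝ (⊤ : ℕ∞) fun p : ℝ × Esp d => gradient (fun y => f (p.1, y)) p.2 := by
  refine contDiff_euclidean.2 fun i => ?_
  simp only [gradient_slice_apply (hf.differentiable (by simp))]
  exact hf.fderiv_apply_const _

theorem contDiff_pdiv_slice {V : ℝ × Esp d → Esp d} (hV : ContDiff ℝ (⊤ : ℕ∞) V) :
    ContDiff ℝ (⊤ : ℕ∞) fun p : ℝ × Esp d => pdiv (fun y => V (p.1, y)) p.2 := by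
  refine ContDiff.sum fun i _ => ?_
  have hVi : ContDiff ℝ (⊤ : ℕ∞) fun p => V p i := contDiff_euclidean.1 hV i
  have h : (fun p : ℝ × Esp d =>
      fderiv ℝ (fun y => V (p.1, y) i) p.2 (EuclideanSpace.single i 1))
      = fun p => fderiv ℝ (fun q => V q i) p (0, EuclideanSpace.single i 1) :=
    funext fun p => (gradient_apply_eq_fderiv _ _ _).symm.trans
      (gradient_slice_apply (hVi.differentiable (by simp)) p.1 p.2 i)
  rw [h]
  exact hVi.fderiv_apply_const _

/-- The time derivative of `‖∇f‖²` is `2 ⟪∇∂ₜf, ∇f⟫`. -/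
theorem hasDerivAt_norm_gradient_slice_sq (hf : ContDiff ℝ (⊤ : ℕ∞) f) (t : ℝ) (x : Esp d) :
    HasDerivAt (fun s => ‖gradient (fun y => f (s, y)) x‖ ^ 2)
      (2 * inner ℝ (gradient (fun y => deriv (fun s => f (s, y)) t) x)
        (gradient (fun y => f (t, y)) x)) t := by
  have hd : Differentiable ℝ f := hf.differentiable (by simp)
  simp only [EuclideanSpace.real_norm_sq_eq, PiLp.inner_apply, deriv_slice hd, Finset.mul_sum]
  refine HasDerivAt.fun_sum fun i _ => ?_
  have hi := hf.fderiv_apply_const ((0, EuclideanSpace.single i 1) : ℝ × Esp d)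
  have ht := hf.fderiv_apply_const ((1, 0) : ℝ × Esp d)
  have h := ((hi.differentiable (by simp) (t, x)).hasFDerivAt.comp_hasDerivAt t
    ((hasDerivAt_id t).prodMk (hasDerivAt_const t x))).pow 2
  rw [gradient_slice_apply (f := fun q => fderiv ℝ f q (1, 0)) (ht.differentiable (by simp)),
    fderiv_fderiv_apply_comm hf]
  refine (h.congr_of_eventuallyEq (.of_forall fun s =>
    congrArg (· ^ 2) (gradient_slice_apply hd s x i))).congr_deriv ?_
  rw [gradient_slice_apply hd]
  simp
  ring

end Slices

/-- Energy dissipation law for the IEQ-transformed system. -/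
theorem ieq_transformed_energy_dissipation (d : ℕ) (hd : 1 ≤ d) (ε B : ℝ)
    (F : ℝ → ℝ) (hF : ContDiff ℝ (⊤ : ℕ∞) F) (hFB : ∀ s : ℝ, 0 < F s + B)
    (H : ℝ → ℝ) (hH : ∀ s : ℝ, H s = deriv F s / Real.sqrt (F s + B))
    (M : ℝ → ℝ) (hM : ContDiff ℝ (⊤ : ℕ∞) M) (hM0 : ∀ s : ℝ, 0 ≤ M s)
    (φ U μ : ℝ × Esp d → ℝ) (hφ : ContDiff ℝ (⊤ : ℕ∞) φ) (hU : ContDiff ℝ (⊤ : ℕ∞) U)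
    (hperφ : ∀ t : ℝ, ZPer fun x => φ (t, x))
    (hperU : ∀ t : ℝ, ZPer fun x => U (t, x))
    (hμ : ∀ (t : ℝ) (x : Esp d),
      μ (t, x) = -ε ^ 2 * plap (fun y => φ (t, y)) x + U (t, x) * H (φ (t, x)))
    (heqφ : ∀ (t : ℝ) (x : Esp d),
      deriv (fun s => φ (s, x)) t
        = pdiv (fun y => M (φ (t, y)) • gradient (fun z => μ (t, z)) y) x)
    (heqU : ∀ (t : ℝ) (x : Esp d),
      deriv (fun s => U (s, x)) t
        = 1 / 2 * H (φ (t, x)) * deriv (fun s => φ (s, x)) t) :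
    ∀ t : ℝ,
      HasDerivAt (fun s => ∫ x in unitCube d,
          (ε ^ 2 / 2 * ‖gradient (fun y => φ (s, y)) x‖ ^ 2 + (U (s, x)) ^ 2))
        (-∫ x in unitCube d,
          M (φ (t, x)) * ‖gradient (fun z => μ (t, z)) x‖ ^ 2) t
      ∧ (-∫ x in unitCube d,
          M (φ (t, x)) * ‖gradient (fun z => μ (t, z)) x‖ ^ 2) ≤ 0 := by
  intro t
  have hφd : Differentiable ℝ φ := hφ.differentiable (by simp)
  have hH' : ContDiff ℝ (⊤ : ℕ∞) H := by
    rw [show H = fun s => deriv F s / √(F s + B) from funext hH]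
    exact (contDiff_infty_iff_deriv.1 hF).2.div ((hF.add contDiff_const).sqrt fun s => (hFB s).ne')
      fun s => (Real.sqrt_pos.2 (hFB s)).ne'
  have hgφ := contDiff_gradient_slice hφ
  have hμ' : ContDiff ℝ (⊤ : ℕ∞) μ := by
    rw [show μ = fun p => -ε ^ 2 * plap (fun y => φ (p.1, y)) p.2 + U p * H (φ p) from
      funext fun p => hμ p.1 p.2]
    exact (contDiff_const.mul (contDiff_pdiv_slice hgφ)).add (hU.mul (hH'.comp hφ))
  have hgμ := contDiff_gradient_slice hμ'
  have hφt : ContDiff ℝ (⊤ : ℕ∞) fun p : ℝ × Esp d => deriv (fun s => φ (s, p.2)) p.1 := by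
    simp only [deriv_slice hφd]
    exact hφ.fderiv_apply_const _
  have hsl : ContDiff ℝ (⊤ : ℕ∞) fun y : Esp d => (t, y) := by fun_prop
  have sφ : ContDiff ℝ (⊤ : ℕ∞) fun y => φ (t, y) := hφ.comp hsl
  have sμ : ContDiff ℝ (⊤ : ℕ∞) fun y => μ (t, y) := hμ'.comp hsl
  have sgφ : ContDiff ℝ (⊤ : ℕ∞) (gradient fun y => φ (t, y)) := hgφ.comp hsl
  have sgμ : ContDiff ℝ (⊤ : ℕ∞) (gradient fun y => μ (t, y)) := hgμ.comp hsl
  have sφt : ContDiff ℝ (⊤ : ℕ∞) fun y => deriv (fun s => φ (s, y)) t := hφt.comp hsl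
  have sJ : ContDiff ℝ (⊤ : ℕ∞) fun y => M (φ (t, y)) • gradient (fun z => μ (t, z)) y :=
    (hM.comp sφ).smul sgμ
  have pφt : ZPer fun y => deriv (fun s => φ (s, y)) t := fun x k => by
    have h : ∀ s, _ = _ := fun s => hperφ s x k
    simp only at h
    simp only [h]
  have pμ : ZPer fun y => μ (t, y) := fun x k => by
    have h1 := (hperφ t).gradient.pdiv x k
    have h2 := hperφ t x k
    have h3 := hperU t x k
    simp only at h2 h3
    simp only [hμ, plap, h1, h2, h3]
  let V : Esp d → Esp d := fun y =>
    (ε ^ 2 * deriv (fun s => φ (s, y)) t) • gradient (fun z => φ (t, z)) y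
      + μ (t, y) • (M (φ (t, y)) • gradient (fun z => μ (t, z)) y)
  have hV : ContDiff ℝ (⊤ : ℕ∞) V :=
    ((contDiff_const.mul sφt).smul sgφ).add (sμ.smul sJ)
  have pV : ZPer V := fun x k => by
    have h1 := pφt x k
    have h2 := (hperφ t).gradient x k
    have h3 := pμ x k
    have h4 := pμ.gradient x k
    have h5 := hperφ t x k
    simp only at h1 h3 h5
    simp only [V, h1, h2, h3, h4, h5]
  have hdivV : ∀ x, pdiv V x
      = ε ^ 2 * inner ℝ (gradient (fun y => deriv (fun s => φ (s, y)) t) x)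
          (gradient (fun y => φ (t, y)) x)
        + 2 * U (t, x) * deriv (fun s => U (s, x)) t
        + M (φ (t, x)) * ‖gradient (fun z => μ (t, z)) x‖ ^ 2 := fun x => by
    have d1 : DifferentiableAt ℝ (fun y => deriv (fun s => φ (s, y)) t) x :=
      sφt.differentiable (by simp) x
    have d2 : DifferentiableAt ℝ (gradient fun y => φ (t, y)) x :=
      sgφ.differentiable (by simp) x
    have d3 : DifferentiableAt ℝ (fun y => μ (t, y)) x := sμ.differentiable (by simp) x
    have d4 := sJ.differentiable (by simp) x
    have hg : gradient (fun y => ε ^ 2 * deriv (fun s => φ (s, y)) t) x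
        = ε ^ 2 • gradient (fun y => deriv (fun s => φ (s, y)) t) x := by
      ext i
      rw [gradient_apply_eq_fderiv, PiLp.smul_apply, gradient_apply_eq_fderiv,
        fderiv_const_mul d1]
      simp
    rw [show pdiv V x = _ from pdiv_add ((d1.const_mul _).fun_smul d2) (d3.fun_smul d4), pdiv_smul (d1.const_mul _) d2,
      pdiv_smul d3 d4, hg, real_inner_smul_left, real_inner_smul_right,
      real_inner_self_eq_norm_sq, ← heqφ, heqU, hμ, plap]
    ring
  have hG : ContDiff ℝ (⊤ : ℕ∞) fun p : ℝ × Esp d =>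
      ε ^ 2 / 2 * ‖gradient (fun y => φ (p.1, y)) p.2‖ ^ 2 + (U p) ^ 2 :=
    (contDiff_const.mul (hgφ.norm_sq ℝ)).add (hU.pow 2)
  have hGt : ∀ x, fderiv ℝ (fun p : ℝ × Esp d =>
      ε ^ 2 / 2 * ‖gradient (fun y => φ (p.1, y)) p.2‖ ^ 2 + (U p) ^ 2) (t, x) (1, 0)
      = pdiv V x - M (φ (t, x)) * ‖gradient (fun z => μ (t, z)) x‖ ^ 2 := fun x => by
    have hUt : HasDerivAt (fun s => U (s, x)) (deriv (fun s => U (s, x)) t) t :=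
      ((hU.differentiable (by simp)).comp (by fun_prop : Differentiable ℝ fun s : ℝ => (s, x))
        t).hasDerivAt
    rw [← deriv_slice (hG.differentiable (by simp)), hdivV]
    refine (((hasDerivAt_norm_gradient_slice_sq hφ t x).const_mul (ε ^ 2 / 2)).add
      (hUt.pow 2)).deriv.trans ?_
    simp
    ring
  have hdiss : Continuous fun x => M (φ (t, x)) * ‖gradient (fun z => μ (t, z)) x‖ ^ 2 :=
    (hM.continuous.comp sφ.continuous).mul (sgμ.continuous.norm.pow 2)
  have hdivc : Continuous (pdiv V) :=
    ((contDiff_pdiv_slice (hV.comp contDiff_snd)).comp hsl).continuous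
  constructor
  · have h := hasDerivAt_setIntegral_of_contDiff volume (isCompact_unitCube d)
      (hG.of_le (by norm_cast)) t
    simp only [hGt] at h
    rwa [integral_sub (hdivc.continuousOn.integrableOn_compact (isCompact_unitCube d))
      (hdiss.continuousOn.integrableOn_compact (isCompact_unitCube d)),
      integral_pdiv_eq_zero (hV.of_le (by norm_cast)) pV, zero_sub] at h
  · exact neg_nonpos.2 (integral_nonneg fun x => mul_nonneg (hM0 _) (sq_nonneg _))
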